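/- Let V be a finite type, T : ℕ, and ℓ a layered relation on V × Fin (T+1) (ℓ (v, s) (w, s') implies (s' : ℕ) = (s : ℕ) + 1) which is persistent: ℓ (v, t) (v, t') holds whenever (t' : ℕ) = (t : ℕ) + 1. Let f(A) = |ρ(A)| be the spread. Let D ⊆ D' be finsets of V × Fin (T+1), let v : V and t, t' : Fin (T+1) with (t' : ℕ) = (t : ℕ) + 1, and suppose (v, t) ∉ ρ(D). Then f(D ∪ {(v, t)}) − f(D) ≥ 1 + ( f(D' ∪ {(v, t')}) − f(D') ), the differences being taken in ℤ. -/

import Mathlib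

/-- The set of layered-graph nodes reachable from the finset `A`. -/
def reachSet {N : Type*} (ℓ : N → N → Prop) (A : Finset N) : Set N :=
  {x : N | ∃ y ∈ A, Relation.ReflTransGen ℓ y x}

/-- The spread of a seed finset `A`: the cardinality of its reachable set. -/
noncomputable def spread {N : Type*} (ℓ : N → N → Prop) (A : Finset N) : ℕ :=
  (reachSet ℓ A).ncard

theorem reachSet_mono {N : Type*} (ℓ : N → N → Prop) {A B : Finset N} (h : A ⊆ B) :
    reachSet ℓ A ⊆ reachSet ℓ B :=
  fun _ ⟨y, hy, hyx⟩ => ⟨y, h hy, hyx⟩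

theorem reachSet_insert {N : Type*} [DecidableEq N] (ℓ : N → N → Prop) (x : N) (A : Finset N) :
    reachSet ℓ (insert x A) = {y | Relation.ReflTransGen ℓ x y} ∪ reachSet ℓ A := by
  ext y
  simp [reachSet]

/-- The marginal gain of a node counts the nodes it newly makes reachable. -/
theorem spread_insert {N : Type*} [Finite N] [DecidableEq N] (ℓ : N → N → Prop) (x : N)
    (A : Finset N) :
    spread ℓ (insert x A) =
      ({y | Relation.ReflTransGen ℓ x y} \ reachSet ℓ A).ncard + spread ℓ A := by
  rw [spread, reachSet_insert, spread, Set.ncard_sdiff_add_ncard _ _ (Set.toFinite _)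
    (Set.toFinite _)]

theorem layer_le_of_reflTransGen {V : Type*} {T : ℕ}
    {ℓ : V × Fin (T + 1) → V × Fin (T + 1) → Prop}
    (hlayer : ∀ (v w : V) (s s' : Fin (T + 1)), ℓ (v, s) (w, s') → (s' : ℕ) = (s : ℕ) + 1)
    {x y : V × Fin (T + 1)} (h : Relation.ReflTransGen ℓ x y) : (x.2 : ℕ) ≤ (y.2 : ℕ) := by
  induction h with
  | refl => exact le_rfl
  | tail _ hbc ih => exact ih.trans ((Nat.le_succ _).trans_eq (hlayer _ _ _ _ hbc).symm)

/-- deterministic core of Lemma 4: for a layered and persistent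
relation `ℓ` on `V × Fin (T+1)`, finsets `D ⊆ D'`, consecutive layers
`t' = t + 1`, and `(v, t) ∉ ρ(D)`, one has
`f(D ∪ {(v, t)}) − f(D) ≥ 1 + (f(D' ∪ {(v, t')}) − f(D'))` in `ℤ`. -/
theorem marginal_gain_time_gap {V : Type*} [Fintype V] [DecidableEq V] (T : ℕ)
    (ℓ : V × Fin (T + 1) → V × Fin (T + 1) → Prop)
    (hlayer : ∀ (v w : V) (s s' : Fin (T + 1)),
      ℓ (v, s) (w, s') → (s' : ℕ) = (s : ℕ) + 1)
    (hpersist : ∀ (v : V) (t t' : Fin (T + 1)),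
      (t' : ℕ) = (t : ℕ) + 1 → ℓ (v, t) (v, t'))
    (D D' : Finset (V × Fin (T + 1))) (hDD' : D ⊆ D')
    (v : V) (t t' : Fin (T + 1)) (htt' : (t' : ℕ) = (t : ℕ) + 1)
    (hv : (v, t) ∉ reachSet ℓ D) :
    (spread ℓ (insert (v, t) D) : ℤ) - (spread ℓ D : ℤ) ≥
      1 + ((spread ℓ (insert (v, t') D') : ℤ) - (spread ℓ D' : ℤ)) := by
  have hnot : (v, t) ∉ {y | Relation.ReflTransGen ℓ (v, t') y} \ reachSet ℓ D' := fun h => by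
    have := layer_le_of_reflTransGen hlayer h.1
    dsimp only at this
    omega
  have hsub : insert (v, t) ({y | Relation.ReflTransGen ℓ (v, t') y} \ reachSet ℓ D') ⊆
      {y | Relation.ReflTransGen ℓ (v, t) y} \ reachSet ℓ D :=
    Set.insert_subset ⟨Relation.ReflTransGen.refl, hv⟩ fun _ hy =>
      ⟨Relation.ReflTransGen.head (hpersist v t t' htt') hy.1,
        fun h => hy.2 (reachSet_mono ℓ hDD' h)⟩
  have hcard := Set.ncard_le_ncard hsub (Set.toFinite _)
  rw [Set.ncard_insert_of_notMem hnot (Set.toFinite _)] at hcard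
  rw [spread_insert, spread_insert]
  omega
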